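/- Let a₀, a₁, a₂ ∈ ℂ with a₀ ≠ 0, and let λ₁ and λ₂ be the roots of the characteristic equation a₀λ² + a₁λ + a₂ = 0. If a₀ · Re(λ₁) · Re(λ₂) ≠ 0, then the constant-coefficient equation a₀x'' + a₁x' + a₂x = 0 is Ulam stable on ℝ, and 1/( |a₀| · |Re(λ₁)| · |Re(λ₂)| ) is an Ulam constant for it on ℝ. -/

import Mathlib

open MeasureTheory Set

/-- `L` is an Ulam constant for the constant-coefficient equation
`a₀ x'' + a₁ x' + a₂ x = 0` on `ℝ` (for `ℂⁿ`-valued functions). -/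
def IsUlamConstant (n : ℕ) (a₀ a₁ a₂ : ℂ) (L : ℝ) : Prop :=
  0 < L ∧ ∀ ε > 0, ∀ ξ ξd ξdd : ℝ → EuclideanSpace ℂ (Fin n),
    (∀ t, HasDerivAt ξ (ξd t) t) →
    (∀ t, HasDerivAt ξd (ξdd t) t) →
    Continuous ξdd →
    (∀ t, ‖a₀ • ξdd t + a₁ • ξd t + a₂ • ξ t‖ ≤ ε) →
    ∃ x xd xdd : ℝ → EuclideanSpace ℂ (Fin n),
      (∀ t, HasDerivAt x (xd t) t) ∧
      (∀ t, HasDerivAt xd (xdd t) t) ∧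
      Continuous xdd ∧
      (∀ t, a₀ • xdd t + a₁ • xd t + a₂ • x t = 0) ∧
      ∀ t, ‖ξ t - x t‖ ≤ L * ε

/-- If `Re lam > 0`, then `u' = lam u + f` with `‖f‖ ≤ C` has a solution bounded by `C / Re lam`. -/
theorem exists_bounded_solution_of_re_pos {E : Type*} [NormedAddCommGroup E] [NormedSpace ℂ E]
    [CompleteSpace E] {lam : ℂ} (hlam : 0 < lam.re) {f : ℝ → E} (hf : Continuous f) {C : ℝ}
    (hC : ∀ t, ‖f t‖ ≤ C) :
    ∃ u : ℝ → E, (∀ t, HasDerivAt u (lam • u t + f t) t) ∧ ∀ t, ‖u t‖ ≤ C / lam.re := by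
  set g : ℝ → E := fun s => Complex.exp (-lam * s) • f s with hg
  have hgc : Continuous g := by fun_prop
  have hgn : ∀ s, ‖g s‖ ≤ C * Real.exp (-lam.re * s) := fun s => by
    have h : ‖Complex.exp (-lam * s)‖ = Real.exp (-lam.re * s) := by
      simp [Complex.norm_exp]
    rw [hg, norm_smul, h, mul_comm]
    exact mul_le_mul_of_nonneg_right (hC s) (Real.exp_pos _).le
  have hei : ∀ t : ℝ, IntegrableOn (fun s => C * Real.exp (-lam.re * s)) (Ioi t) := fun t =>
    (integrableOn_exp_mul_Ioi (neg_lt_zero.2 hlam) t).const_mul C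
  have hgi : ∀ t : ℝ, IntegrableOn g (Ioi t) := fun t =>
    (hei t).mono' hgc.aestronglyMeasurable (Filter.Eventually.of_forall hgn)
  have hsplit : ∀ t : ℝ, ∫ s in Ioi t, g s = (∫ s in Ioi 0, g s) - ∫ s in (0 : ℝ)..t, g s :=
    fun t => by
      rw [← intervalIntegral.integral_interval_add_Ioi (hgi 0) (hgi t), add_sub_cancel_left]
  have hexp : ∀ t : ℝ, Complex.exp (lam * t) * Complex.exp (-lam * t) = 1 := fun t => by
    rw [← Complex.exp_add]; simp
  refine ⟨fun t => -(Complex.exp (lam * t) • ∫ s in Ioi t, g s), fun t => ?_, fun t => ?_⟩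
  · have hI : HasDerivAt (fun t => ∫ s in Ioi t, g s) (-g t) t := by
      rw [funext hsplit]
      exact (hgc.integral_hasStrictDerivAt 0 t).hasDerivAt.const_sub _
    have hE : HasDerivAt (fun t : ℝ => Complex.exp (lam * t)) (Complex.exp (lam * t) * lam) t := by
      simpa using ((hasDerivAt_id t).ofReal_comp.const_mul lam).cexp
    refine (hE.smul hI).neg.congr_deriv ?_
    have hfg : Complex.exp (lam * t) • g t = f t := by rw [hg, smul_smul, hexp, one_smul]
    rw [← hfg]
    module
  · have hn : ‖Complex.exp (lam * t)‖ = Real.exp (lam.re * t) := by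
      simp [Complex.norm_exp]
    have hb : ‖∫ s in Ioi t, g s‖ ≤ C * (Real.exp (-lam.re * t) / lam.re) := by
      refine (norm_integral_le_of_norm_le (hei t) (Filter.Eventually.of_forall hgn)).trans_eq ?_
      rw [integral_const_mul, integral_exp_mul_Ioi (neg_lt_zero.2 hlam), neg_div_neg_eq]
    rw [norm_neg, norm_smul, hn]
    calc Real.exp (lam.re * t) * ‖∫ s in Ioi t, g s‖
        ≤ Real.exp (lam.re * t) * (C * (Real.exp (-lam.re * t) / lam.re)) := by gcongr
      _ = Real.exp (lam.re * t) * Real.exp (-lam.re * t) * (C / lam.re) := by ring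
      _ = C / lam.re := by rw [← Real.exp_add]; simp

/-- If `Re lam ≠ 0`, then `u' = lam u + f` with `‖f‖ ≤ C` has a solution bounded by
`C / |Re lam|`. -/
theorem exists_bounded_solution {E : Type*} [NormedAddCommGroup E] [NormedSpace ℂ E]
    [CompleteSpace E] {lam : ℂ} (hlam : lam.re ≠ 0) {f : ℝ → E} (hf : Continuous f) {C : ℝ}
    (hC : ∀ t, ‖f t‖ ≤ C) :
    ∃ u : ℝ → E, (∀ t, HasDerivAt u (lam • u t + f t) t) ∧ ∀ t, ‖u t‖ ≤ C / |lam.re| := by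
  rcases hlam.lt_or_gt with h | h
  · obtain ⟨w, hw, hwb⟩ := exists_bounded_solution_of_re_pos (lam := -lam) (by simpa using h)
      (f := fun t => -f (-t)) (by fun_prop) (C := C) (fun t => by simpa using hC (-t))
    refine ⟨fun t => w (-t), fun t => ?_, fun t => ?_⟩
    · refine ((hw (-t)).scomp t (hasDerivAt_neg t)).congr_deriv ?_
      rw [neg_neg]
      module
    · simpa [abs_of_neg h] using hwb (-t)
  · simpa [abs_of_pos h] using exists_bounded_solution_of_re_pos h hf hC

/-- Corollary 3.2. If `λ₁, λ₂` are the roots of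
`a₀ λ² + a₁ λ + a₂ = 0` with `a₀ ≠ 0` and `a₀ Re(λ₁) Re(λ₂) ≠ 0`, then
`a₀ x'' + a₁ x' + a₂ x = 0` is Ulam stable on `ℝ` with Ulam constant
`1/(|a₀| |Re λ₁| |Re λ₂|)`. -/
theorem const_coeff_ulam_stable (n : ℕ) (a₀ a₁ a₂ lam₁ lam₂ : ℂ) (h₀ : a₀ ≠ 0)
    (hroots : ∀ z : ℂ, a₀ * z ^ 2 + a₁ * z + a₂ = a₀ * (z - lam₁) * (z - lam₂))
    (hre : a₀ * (lam₁.re : ℂ) * (lam₂.re : ℂ) ≠ 0) :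
    (∃ L, IsUlamConstant n a₀ a₁ a₂ L) ∧
      IsUlamConstant n a₀ a₁ a₂ (1 / (‖a₀‖ * |lam₁.re| * |lam₂.re|)) := by
  have hl₁ : lam₁.re ≠ 0 := fun h => hre (by simp [h])
  have hl₂ : lam₂.re ≠ 0 := fun h => hre (by simp [h])
  have ha₂ : a₂ = a₀ * lam₁ * lam₂ := by linear_combination hroots 0
  have ha₁ : a₁ = -(a₀ * (lam₁ + lam₂)) := by linear_combination hroots 1 - hroots 0
  suffices h : IsUlamConstant n a₀ a₁ a₂ (1 / (‖a₀‖ * |lam₁.re| * |lam₂.re|)) from ⟨⟨_, h⟩, h⟩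
  refine ⟨by positivity, fun ε _ ξ ξd ξdd hξ hξd hc hb => ?_⟩
  have hξc : Continuous ξ := continuous_iff_continuousAt.2 fun t => (hξ t).continuousAt
  have hξdc : Continuous ξd := continuous_iff_continuousAt.2 fun t => (hξd t).continuousAt
  set f := fun t => a₀⁻¹ • (a₀ • ξdd t + a₁ • ξd t + a₂ • ξ t) with hf
  have hfc : Continuous f := by fun_prop
  have hfb : ∀ t, ‖f t‖ ≤ ε / ‖a₀‖ := fun t => by
    rw [hf, norm_smul, norm_inv, inv_mul_eq_div]
    gcongr
    exact hb t
  obtain ⟨u, hu, hub⟩ := exists_bounded_solution hl₁ hfc hfb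
  have huc : Continuous u := continuous_iff_continuousAt.2 fun t => (hu t).continuousAt
  obtain ⟨v, hv, hvb⟩ := exists_bounded_solution hl₂ huc hub
  have hvc : Continuous v := continuous_iff_continuousAt.2 fun t => (hv t).continuousAt
  refine ⟨fun t => ξ t - v t, fun t => ξd t - (lam₂ • v t + u t),
    fun t => ξdd t - (lam₂ • (lam₂ • v t + u t) + (lam₁ • u t + f t)),
    fun t => (hξ t).sub (hv t), fun t => (hξd t).sub (((hv t).const_smul lam₂).add (hu t)),
    by fun_prop, fun t => ?_, fun t => ?_⟩
  · have hft : a₀ • f t = a₀ • ξdd t + a₁ • ξd t + a₂ • ξ t := smul_inv_smul₀ h₀ _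
    rw [← sub_eq_zero.2 hft.symm, ha₁, ha₂]
    module
  · rw [sub_sub_cancel]
    refine (hvb t).trans_eq ?_
    field_simp
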